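/- Let R be a principal ideal domain with field of fractions F, let 0 < r < n, f = n − r, let p ∈ R be prime, K ∈ M_{r,f}(R), and J = (p·I_r | K), with N the nullspace of J in R^n and W the R-span of V(1), …, V(f). Let H ∈ M_{r,f}(R) be a matrix whose reduction H̄ modulo Rp is the reduced row echelon form of K̄ over the field R̄ = R/Rp, let s = rank(K̄), and suppose the leading (pivot) columns of H̄ are columns 1, …, s. Define z_j = p·V(j) for 1 ≤ j ≤ s, and z_{s+i} = −(H_{1,s+i}·V(1) + ⋯ + H_{s,s+i}·V(s)) + V(s+i) for 1 ≤ i ≤ f − s. Then {z_1, …, z_f} is a basis of N. -/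

import Mathlib

open scoped Pointwise

/-- The matrix `J = (d·I_r | K) ∈ M_{r,n}(R)`: its first `r` columns form `d·I_r`
and its last `n - r` columns form `K`. -/
noncomputable def Jmat (R : Type*) [CommRing R] (r n : ℕ) (d : R)
    (K : Matrix (Fin r) (Fin (n - r)) R) : Matrix (Fin r) (Fin n) R := fun i j =>
  if hj : (j : ℕ) < r then (if (i : ℕ) = (j : ℕ) then d else 0)
  else K i ⟨(j : ℕ) - r, by have := j.isLt; omega⟩

/-- The vector `V(j) ∈ F^n` whose `i`-th coordinate is `-K_{i,j}/d` for `i < r`,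
which is `1` in position `r + j`, and `0` elsewhere. -/
noncomputable def Vvec (R : Type*) [CommRing R] [IsDomain R] (r n : ℕ) (d : R)
    (K : Matrix (Fin r) (Fin (n - r)) R) (j : Fin (n - r)) :
    Fin n → FractionRing R := fun i =>
  if hi : (i : ℕ) < r then
    -(algebraMap R (FractionRing R) (K ⟨(i : ℕ), hi⟩ j)) / algebraMap R (FractionRing R) d
  else if (i : ℕ) = r + (j : ℕ) then 1 else 0

/-- The coordinatewise inclusion `R^n → F^n`, as an `R`-linear map. -/
noncomputable def toFrac (R : Type*) [CommRing R] (n : ℕ) :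
    (Fin n → R) →ₗ[R] (Fin n → FractionRing R) :=
  LinearMap.pi fun i => (Algebra.linearMap R (FractionRing R)).comp (LinearMap.proj i)

/-- The nullspace `N = {X ∈ R^n : JX = 0}` of `J` in `R^n`, viewed (via the inclusion
`R^n ⊆ F^n`) as an `R`-submodule of `F^n`. -/
noncomputable def Nsub (R : Type*) [CommRing R] [IsDomain R] (r n : ℕ) (d : R)
    (K : Matrix (Fin r) (Fin (n - r)) R) : Submodule R (Fin n → FractionRing R) :=
  (LinearMap.ker (Jmat R r n d K).mulVecLin).map (toFrac R n)

/-- `W`, the `R`-span of `V(1), …, V(f)` in `F^n`. -/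
noncomputable def Wsub (R : Type*) [CommRing R] [IsDomain R] (r n : ℕ) (d : R)
    (K : Matrix (Fin r) (Fin (n - r)) R) : Submodule R (Fin n → FractionRing R) :=
  Submodule.span R (Set.range (Vvec R r n d K))

/-- The vectors `z_1, …, z_f`: `z_j = p·V(j)` for `j ≤ s`, and
`z_{s+i} = −(H_{1,s+i}·V(1) + ⋯ + H_{s,s+i}·V(s)) + V(s+i)` for `1 ≤ i ≤ f − s`. -/
noncomputable def zvec (R : Type*) [CommRing R] [IsDomain R] (r n : ℕ) (p : R)
    (K H : Matrix (Fin r) (Fin (n - r)) R) (s : ℕ) (hsr : s ≤ r) (hsf : s ≤ n - r)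
    (j : Fin (n - r)) : Fin n → FractionRing R :=
  if (j : ℕ) < s then p • Vvec R r n p K j
  else -(∑ k : Fin s, H (Fin.castLE hsr k) j • Vvec R r n p K (Fin.castLE hsf k)) +
    Vvec R r n p K j

/-- The coordinates of `z_j` with respect to `V(1), …, V(f)`. -/
noncomputable def zcoeff {R : Type*} [CommRing R] {r f : ℕ} (p : R)
    (H : Matrix (Fin r) (Fin f) R) (s : ℕ) (hsr : s ≤ r) (hsf : s ≤ f) (j : Fin f) :
    Fin f → R :=
  if (j : ℕ) < s then p • Pi.single j 1
  else -(∑ k : Fin s, H (Fin.castLE hsr k) j • Pi.single (Fin.castLE hsf k) 1) + Pi.single j 1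

section Coefficients

variable {R : Type*} [CommRing R] {r f : ℕ} {p : R} {H : Matrix (Fin r) (Fin f) R} {s : ℕ}
  {hsr : s ≤ r} {hsf : s ≤ f}

theorem zcoeff_apply_of_lt (j k : Fin f) (hk : (k : ℕ) < s) :
    zcoeff p H s hsr hsf j k =
      (if j = k then p else 0) - if s ≤ (j : ℕ) then H ⟨k, hk.trans_le hsr⟩ j else 0 := by
  unfold zcoeff
  by_cases hj : (j : ℕ) < s
  · simp [hj, not_le.mpr hj, Pi.single_apply, eq_comm]
  · have hne : k ≠ j := by rintro rfl; exact hj hk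
    have hsum : ∑ x : Fin s, (if k = Fin.castLE hsf x then H (Fin.castLE hsr x) j else 0) =
        H ⟨k, hk.trans_le hsr⟩ j := by
      rw [Finset.sum_eq_single (⟨k, hk⟩ : Fin s)]
      · simp
      · intro b _ hb
        rw [if_neg]
        rintro rfl
        exact hb rfl
      · simp
    simp [hj, Pi.single_apply, hne, hne.symm, not_lt.mp hj, hsum]

theorem zcoeff_apply_of_le (j k : Fin f) (hk : s ≤ (k : ℕ)) :
    zcoeff p H s hsr hsf j k = if j = k then 1 else 0 := by
  unfold zcoeff
  by_cases hj : (j : ℕ) < s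
  · have hne : k ≠ j := by rintro rfl; omega
    simp [hj, hne, hne.symm]
  · have hne : ∀ x : Fin s, k ≠ Fin.castLE hsf x := by
      rintro x rfl
      have := x.isLt
      simp at hk
      omega
    simp [hj, Pi.single_apply, hne, eq_comm]

theorem linearCombination_zcoeff_apply_of_lt (a : Fin f → R) (k : Fin f) (hk : (k : ℕ) < s) :
    Fintype.linearCombination R (zcoeff p H s hsr hsf) a k =
      p * a k - ∑ j : Fin f, if s ≤ (j : ℕ) then H ⟨k, hk.trans_le hsr⟩ j * a j else 0 := by
  simp [Fintype.linearCombination_apply, zcoeff_apply_of_lt _ _ hk, mul_sub,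
    Finset.sum_sub_distrib, mul_comm]

theorem linearCombination_zcoeff_apply_of_le (a : Fin f → R) (k : Fin f) (hk : s ≤ (k : ℕ)) :
    Fintype.linearCombination R (zcoeff p H s hsr hsf) a k = a k := by
  simp [Fintype.linearCombination_apply, zcoeff_apply_of_le _ _ hk]

theorem linearIndependent_zcoeff [IsDomain R] (hp : p ≠ 0) :
    LinearIndependent R (zcoeff p H s hsr hsf) := by
  rw [Fintype.linearIndependent_iff]
  intro a ha
  replace ha : Fintype.linearCombination R (zcoeff p H s hsr hsf) a = 0 := ha
  have hle : ∀ k : Fin f, s ≤ (k : ℕ) → a k = 0 := fun k hk => by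
    rw [← linearCombination_zcoeff_apply_of_le (p := p) (H := H) (hsr := hsr) (hsf := hsf) a k hk,
      ha, Pi.zero_apply]
  intro k
  rcases le_or_gt s (k : ℕ) with hk | hk
  · exact hle k hk
  · have h := linearCombination_zcoeff_apply_of_lt (p := p) (H := H) (hsr := hsr) (hsf := hsf) a k hk
    rw [ha, Pi.zero_apply, Finset.sum_eq_zero, sub_zero] at h
    · exact (mul_eq_zero.mp h.symm).resolve_left hp
    · intro j _
      split_ifs with hj
      · rw [hle j hj, mul_zero]
      · rfl

/-- When the first `s` columns of `H` reduce to pivot columns modulo `p`, row `i < s` of the system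
`H c ≡ 0` only involves `c i` and the non-pivot coordinates of `c`. -/
theorem dvd_mulVec_iff_of_pivot
    (hpivot : ∀ (i : Fin r) (j : Fin f), (i : ℕ) < s → (j : ℕ) < s →
      p ∣ H i j - if (i : ℕ) = (j : ℕ) then 1 else 0)
    (c : Fin f → R) (k : Fin f) (hk : (k : ℕ) < s) (hkr : (k : ℕ) < r) :
    p ∣ H.mulVec c ⟨k, hkr⟩ ↔
      p ∣ c k + ∑ j : Fin f, if s ≤ (j : ℕ) then H ⟨k, hkr⟩ j * c j else 0 := by
  apply dvd_iff_dvd_of_dvd_sub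
  have hck : c k = ∑ j, if k = j then c j else 0 := by simp
  rw [hck, Matrix.mulVec, dotProduct, ← Finset.sum_add_distrib, ← Finset.sum_sub_distrib]
  refine Finset.dvd_sum fun j _ => ?_
  rcases le_or_gt s (j : ℕ) with hj | hj
  · have hne : k ≠ j := by rintro rfl; omega
    simp [hj, hne]
  · have h := (hpivot ⟨k, hkr⟩ j hk hj).mul_right (c j)
    simpa [not_le.mpr hj, sub_mul, Fin.ext_iff] using h

theorem mem_span_range_zcoeff_iff
    (hpivot : ∀ (i : Fin r) (j : Fin f), (i : ℕ) < s → (j : ℕ) < s →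
      p ∣ H i j - if (i : ℕ) = (j : ℕ) then 1 else 0)
    (hzero : ∀ (i : Fin r) (j : Fin f), s ≤ (i : ℕ) → p ∣ H i j) (c : Fin f → R) :
    c ∈ Submodule.span R (Set.range (zcoeff p H s hsr hsf)) ↔ ∀ i, p ∣ H.mulVec c i := by
  rw [← Fintype.range_linearCombination, LinearMap.mem_range]
  constructor
  · rintro ⟨a, rfl⟩ i
    rcases le_or_gt s (i : ℕ) with hi | hi
    · rw [Matrix.mulVec, dotProduct]
      exact Finset.dvd_sum fun j _ => (hzero i j hi).mul_right _
    · refine (dvd_mulVec_iff_of_pivot hpivot _ ⟨i, hi.trans_le hsf⟩ hi i.isLt).mpr ?_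
      rw [linearCombination_zcoeff_apply_of_lt a ⟨i, hi.trans_le hsf⟩ hi]
      refine Dvd.intro (a ⟨i, hi.trans_le hsf⟩) ?_
      rw [eq_comm, sub_add_eq_add_sub, sub_eq_iff_eq_add, add_right_inj]
      refine Finset.sum_congr rfl fun j _ => ?_
      split_ifs with hj
      · rw [linearCombination_zcoeff_apply_of_le a j hj]
      · rfl
  · intro h
    have hdvd : ∀ k : Fin f, ∃ b, (hk : (k : ℕ) < s) →
        c k + (∑ j : Fin f, if s ≤ (j : ℕ) then H ⟨k, hk.trans_le hsr⟩ j * c j else 0) = p * b := by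
      intro k
      by_cases hk : (k : ℕ) < s
      · obtain ⟨b, hb⟩ := (dvd_mulVec_iff_of_pivot hpivot c k hk (hk.trans_le hsr)).mp (h _)
        exact ⟨b, fun _ => hb⟩
      · exact ⟨0, fun h' => absurd h' hk⟩
    choose b hb using hdvd
    refine ⟨fun k => if (k : ℕ) < s then b k else c k, funext fun k => ?_⟩
    rcases le_or_gt s (k : ℕ) with hk | hk
    · rw [linearCombination_zcoeff_apply_of_le _ k hk, if_neg (not_lt.mpr hk)]
    · rw [linearCombination_zcoeff_apply_of_lt _ k hk, if_pos hk, ← hb k hk, sub_eq_iff_eq_add,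
        add_right_inj]
      refine Finset.sum_congr rfl fun j _ => ?_
      split_ifs with hj hj'
      · omega
      · rfl
      · rfl

end Coefficients

theorem dvd_mulVec_iff_mk_mulVec_eq_zero {R m n : Type*} [CommRing R] [Fintype n] (p : R)
    (A : Matrix m n R) (c : n → R) :
    (∀ i, p ∣ A.mulVec c i) ↔
      (A.map (Ideal.Quotient.mk (Ideal.span {p}))).mulVec
        (Ideal.Quotient.mk (Ideal.span {p}) ∘ c) = 0 := by
  rw [funext_iff]
  refine forall_congr' fun i => ?_
  rw [← RingHom.map_mulVec, Pi.zero_apply, Ideal.Quotient.eq_zero_iff_dvd]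

/-- Row equivalent matrices modulo `p` have the same null vectors modulo `p`. -/
theorem dvd_mulVec_iff_of_row_equiv {R m n : Type*} [CommRing R] [Fintype m] [DecidableEq m]
    [Fintype n] {p : R} {A B : Matrix m n R}
    (E : (Matrix m m (R ⧸ Ideal.span {p}))ˣ)
    (hE : E.val * A.map (Ideal.Quotient.mk (Ideal.span {p})) =
      B.map (Ideal.Quotient.mk (Ideal.span {p}))) (c : n → R) :
    (∀ i, p ∣ B.mulVec c i) ↔ ∀ i, p ∣ A.mulVec c i := by
  rw [dvd_mulVec_iff_mk_mulVec_eq_zero, dvd_mulVec_iff_mk_mulVec_eq_zero, ← hE,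
    ← Matrix.mulVec_mulVec]
  refine ⟨fun h => ?_, fun h => by rw [h, Matrix.mulVec_zero]⟩
  simpa [Matrix.mulVec_mulVec, ← Matrix.mul_assoc] using congrArg (E⁻¹.val.mulVec ·) h

section Nullspace

variable {R : Type*} [CommRing R] {r n : ℕ} {p : R} {K : Matrix (Fin r) (Fin (n - r)) R}

theorem Jmat_mulVec (hrn : r < n) (x : Fin n → R) (i : Fin r) :
    (Jmat R r n p K).mulVec x i = p * x ⟨i, i.isLt.trans hrn⟩ +
      K.mulVec (fun j => x ⟨r + j, by omega⟩) i := by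
  have e : ∑ j, Jmat R r n p K i j * x j = _ :=
    (Equiv.sum_comp (finSumFinEquiv.trans (finCongr (Nat.add_sub_cancel' hrn.le)))
      fun j => Jmat R r n p K i j * x j).symm
  rw [Matrix.mulVec, dotProduct, e, Fintype.sum_sum_type]
  congr 1
  · rw [Finset.sum_eq_single i]
    · simp [Jmat]
      rfl
    · intro b _ hb
      simp [Jmat, Fin.val_ne_of_ne hb.symm]
    · simp
  · refine Finset.sum_congr rfl fun j _ => ?_
    simp only [Jmat, Equiv.trans_apply, finSumFinEquiv_apply_right, finCongr_apply, Fin.val_cast,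
      Fin.val_natAdd, Nat.not_lt.mpr (Nat.le_add_right r _), dite_false, Nat.add_sub_cancel_left]
    rfl

variable [IsDomain R]

theorem linearCombination_Vvec_apply_of_lt (c : Fin (n - r) → R) (i : Fin n) (hi : (i : ℕ) < r) :
    Fintype.linearCombination R (Vvec R r n p K) c i =
      -algebraMap R (FractionRing R) (K.mulVec c ⟨i, hi⟩) / algebraMap R (FractionRing R) p := by
  simp [Fintype.linearCombination_apply, Vvec, hi, Matrix.mulVec, dotProduct, Algebra.smul_def,
    neg_div, Finset.sum_div, mul_comm, mul_div_assoc]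

theorem linearCombination_Vvec_apply_add (c : Fin (n - r) → R) (j : Fin (n - r)) :
    Fintype.linearCombination R (Vvec R r n p K) c ⟨r + j, by omega⟩ =
      algebraMap R (FractionRing R) (c j) := by
  simp [Fintype.linearCombination_apply, Vvec, Algebra.smul_def, Fin.val_inj]

theorem ker_linearCombination_Vvec :
    LinearMap.ker (Fintype.linearCombination R (Vvec R r n p K)) = ⊥ := by
  refine LinearMap.ker_eq_bot'.mpr fun c hc => funext fun j => ?_
  have h := linearCombination_Vvec_apply_add (p := p) (K := K) c j
  rw [hc, Pi.zero_apply] at h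
  exact IsFractionRing.injective R (FractionRing R) (by rw [← h, Pi.zero_apply, map_zero])

/-- The nullspace of `J` consists of the combinations of the `V(j)` whose coefficient vector `c`
satisfies `K c ≡ 0` modulo `p`. -/
theorem mem_Nsub_iff (hrn : r < n) (hp : p ≠ 0) (x : Fin n → FractionRing R) :
    x ∈ Nsub R r n p K ↔ ∃ c : Fin (n - r) → R, (∀ i, p ∣ K.mulVec c i) ∧
      Fintype.linearCombination R (Vvec R r n p K) c = x := by
  have hp' : algebraMap R (FractionRing R) p ≠ 0 := by simpa using hp
  have hlast : ∀ i : Fin n, ¬ (i : ℕ) < r → ∃ j : Fin (n - r), i = ⟨r + j, by omega⟩ :=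
    fun i hi => ⟨⟨i - r, by omega⟩, Fin.ext (by simp; omega)⟩
  simp only [Nsub, Submodule.mem_map, LinearMap.mem_ker, Matrix.mulVecLin_apply]
  constructor
  · rintro ⟨y, hy, rfl⟩
    have hrow : ∀ i : Fin r, K.mulVec (fun j => y ⟨r + j, by omega⟩) i =
        p * -y ⟨i, i.isLt.trans hrn⟩ := fun i => by
      have h := congrFun hy i
      rw [Jmat_mulVec hrn, Pi.zero_apply] at h
      linear_combination h
    refine ⟨fun j => y ⟨r + j, by omega⟩, fun i => ⟨_, hrow i⟩, funext fun i => ?_⟩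
    by_cases hi : (i : ℕ) < r
    · rw [linearCombination_Vvec_apply_of_lt _ i hi, hrow, div_eq_iff hp']
      simp [toFrac, mul_comm]
    · obtain ⟨j, rfl⟩ := hlast i hi
      rw [linearCombination_Vvec_apply_add]
      rfl
  · rintro ⟨c, hc, rfl⟩
    choose b hb using hc
    refine ⟨fun i => if hi : (i : ℕ) < r then -b ⟨i, hi⟩ else c ⟨i - r, by omega⟩,
      funext fun i => ?_, funext fun i => ?_⟩
    · rw [Jmat_mulVec hrn]
      simp [hb]
    · by_cases hi : (i : ℕ) < r
      · rw [linearCombination_Vvec_apply_of_lt _ i hi, hb, eq_div_iff hp']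
        simp [toFrac, hi, mul_comm]
      · obtain ⟨j, rfl⟩ := hlast i hi
        rw [linearCombination_Vvec_apply_add]
        simp [toFrac]

theorem zvec_eq_linearCombination_comp_zcoeff {H : Matrix (Fin r) (Fin (n - r)) R} {s : ℕ}
    {hsr : s ≤ r} {hsf : s ≤ n - r} :
    zvec R r n p K H s hsr hsf =
      Fintype.linearCombination R (Vvec R r n p K) ∘ zcoeff p H s hsr hsf := by
  funext j
  simp only [zvec, zcoeff, Function.comp_apply]
  split_ifs <;> simp [Fintype.linearCombination_apply_single]

end Nullspace

/-- Suppose `d = p` is prime, let `H̄` (the reduction of `H` mod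
`Rp`) be the reduced row echelon form of `K̄` over `R̄ = R/Rp`, with
`s = rank(K̄)` and pivot columns `1, …, s`. Then the vectors `z_1, …, z_f`
(`z_j = p·V(j)` for `j ≤ s` and `z_{s+i} = −(H_{1,s+i}V(1)+⋯+H_{s,s+i}V(s))+V(s+i)`)
form a basis of `N`. -/
theorem zvec_basis_of_N
    (R : Type*) [CommRing R] [IsDomain R] [IsPrincipalIdealRing R]
    (r n : ℕ) (hr : 0 < r) (hrn : r < n) (p : R) (hp : Prime p)
    (K H : Matrix (Fin r) (Fin (n - r)) R)
    (s : ℕ) (hs : s = (K.map (Ideal.Quotient.mk (Ideal.span {p}))).rank)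
    (hsr : s ≤ r) (hsf : s ≤ n - r)
    (hpivot : ∀ (i : Fin r) (j : Fin (n - r)), (i : ℕ) < s → (j : ℕ) < s →
      Ideal.Quotient.mk (Ideal.span {p}) (H i j) = if (i : ℕ) = (j : ℕ) then 1 else 0)
    (hzero : ∀ (i : Fin r) (j : Fin (n - r)), s ≤ (i : ℕ) →
      Ideal.Quotient.mk (Ideal.span {p}) (H i j) = 0)
    (hrowequiv : ∃ E : (Matrix (Fin r) (Fin r) (R ⧸ Ideal.span {p}))ˣ,
      E.val * K.map (Ideal.Quotient.mk (Ideal.span {p})) =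
        H.map (Ideal.Quotient.mk (Ideal.span {p}))) :
    LinearIndependent R (zvec R r n p K H s hsr hsf) ∧
      Submodule.span R (Set.range (zvec R r n p K H s hsr hsf)) = Nsub R r n p K := by
  obtain ⟨E, hE⟩ := hrowequiv
  rw [zvec_eq_linearCombination_comp_zcoeff]
  refine ⟨(linearIndependent_zcoeff hp.ne_zero).map' _ ker_linearCombination_Vvec, ?_⟩
  ext x
  rw [Set.range_comp, ← Submodule.map_span, mem_Nsub_iff hrn hp.ne_zero, Submodule.mem_map]
  refine exists_congr fun c => and_congr_left fun _ => ?_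
  rw [← dvd_mulVec_iff_of_row_equiv E hE]
  refine mem_span_range_zcoeff_iff (fun i j hi hj => ?_) (fun i j hi => ?_) c
  · rw [← Ideal.Quotient.eq_zero_iff_dvd, map_sub, hpivot i j hi hj]
    split_ifs <;> simp
  · rw [← Ideal.Quotient.eq_zero_iff_dvd, hzero i j hi]
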